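/- Let a, b ∈ 𝔻 be distinct and let z = (z₁,z₂) ∈ 𝔻² satisfy log|z₂| > log|φ_a(z₁)| + log|φ_b(z₁)|. Then limsup_{ε→0, ε≠0} L^ε_{a0bV}(z) ≤ min{ L_{a0b0}(z), L_{a0bV}(z) }, where the limsup is over complex ε ≠ 0 tending to 0. -/

import Mathlib

open Complex Metric Filter Topology

noncomputable section

/-- The open unit disc in `ℂ`. -/
def unitDisc : Set ℂ := Metric.ball 0 1

/-- Extended-real logarithm, with the convention `log 0 = ⊥`. -/
def elog (x : ℝ) : EReal := if x = 0 then ⊥ else ((Real.log x : ℝ) : EReal)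

/-- The Möbius involution of the unit disc exchanging `ξ` and `0`. -/
def mobius (ξ ζ : ℂ) : ℂ := (ξ - ζ) / (1 - (starRingEnd ℂ) ξ * ζ)

/-- An analytic disc in the bidisc `𝔻²`, given by its two components. -/
def AnalyticDisc2 (φ₁ φ₂ : ℂ → ℂ) : Prop :=
  DifferentiableOn ℂ φ₁ unitDisc ∧ DifferentiableOn ℂ φ₂ unitDisc ∧
  (∀ w ∈ unitDisc, φ₁ w ∈ unitDisc) ∧ (∀ w ∈ unitDisc, φ₂ w ∈ unitDisc)

/-- The Lempert function with the two simple poles `(a,0)`, `(b,0)` in the bidisc. -/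
def La0b0 (a b : ℂ) (z : ℂ × ℂ) : EReal :=
  sInf { t : EReal | ∃ (φ₁ φ₂ : ℂ → ℂ) (ζ₁ ζ₂ : ℂ),
    AnalyticDisc2 φ₁ φ₂ ∧ ζ₁ ∈ unitDisc ∧ ζ₂ ∈ unitDisc ∧
    φ₁ 0 = z.1 ∧ φ₂ 0 = z.2 ∧
    φ₁ ζ₁ = a ∧ φ₂ ζ₁ = 0 ∧ φ₁ ζ₂ = b ∧ φ₂ ζ₂ = 0 ∧
    t = elog (‖ζ₁‖) + elog (‖ζ₂‖) }

/-- The generalized Lempert function with vertical indicator at `(a,0)` and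
simple pole `(b,0)`. -/
def LaVb0 (a b : ℂ) (z : ℂ × ℂ) : EReal :=
  sInf { t : EReal | ∃ (φ₁ φ₂ : ℂ → ℂ) (ζ₁ ζ₂ : ℂ),
    AnalyticDisc2 φ₁ φ₂ ∧ ζ₁ ∈ unitDisc ∧ ζ₂ ∈ unitDisc ∧
    φ₁ 0 = z.1 ∧ φ₂ 0 = z.2 ∧
    φ₁ ζ₁ = a ∧ φ₂ ζ₁ = 0 ∧ φ₁ ζ₂ = b ∧ φ₂ ζ₂ = 0 ∧
    deriv φ₁ ζ₁ = 0 ∧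
    t = elog (‖ζ₁‖) + elog (‖ζ₁‖) + elog (‖ζ₂‖) }

/-- The generalized Lempert function with simple pole `(a,0)` and vertical
indicator at `(b,0)`. -/
def La0bV (a b : ℂ) (z : ℂ × ℂ) : EReal :=
  sInf { t : EReal | ∃ (φ₁ φ₂ : ℂ → ℂ) (ζ₁ ζ₂ : ℂ),
    AnalyticDisc2 φ₁ φ₂ ∧ ζ₁ ∈ unitDisc ∧ ζ₂ ∈ unitDisc ∧
    φ₁ 0 = z.1 ∧ φ₂ 0 = z.2 ∧
    φ₁ ζ₁ = a ∧ φ₂ ζ₁ = 0 ∧ φ₁ ζ₂ = b ∧ φ₂ ζ₂ = 0 ∧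
    deriv φ₁ ζ₂ = 0 ∧
    t = elog (‖ζ₁‖) + elog (‖ζ₂‖) + elog (‖ζ₂‖) }

/-- The generalized Lempert function with vertical indicators at `(a,0)` and `(b,0)`. -/
def LaVbV (a b : ℂ) (z : ℂ × ℂ) : EReal :=
  sInf { t : EReal | ∃ (φ₁ φ₂ : ℂ → ℂ) (ζ₁ ζ₂ : ℂ),
    AnalyticDisc2 φ₁ φ₂ ∧ ζ₁ ∈ unitDisc ∧ ζ₂ ∈ unitDisc ∧
    φ₁ 0 = z.1 ∧ φ₂ 0 = z.2 ∧
    φ₁ ζ₁ = a ∧ φ₂ ζ₁ = 0 ∧ φ₁ ζ₂ = b ∧ φ₂ ζ₂ = 0 ∧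
    deriv φ₁ ζ₁ = 0 ∧ deriv φ₁ ζ₂ = 0 ∧
    t = elog (‖ζ₁‖) + elog (‖ζ₁‖)
        + elog (‖ζ₂‖) + elog (‖ζ₂‖) }

/-- Coman's Lempert function with the three simple poles `(a,0)`, `(b,0)`, `(b,ε)`. -/
def Leps3 (a b ε : ℂ) (z : ℂ × ℂ) : EReal :=
  sInf { t : EReal | ∃ (φ₁ φ₂ : ℂ → ℂ) (ζ₁ ζ₂ ζ₃ : ℂ),
    AnalyticDisc2 φ₁ φ₂ ∧ ζ₁ ∈ unitDisc ∧ ζ₂ ∈ unitDisc ∧ ζ₃ ∈ unitDisc ∧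
    φ₁ 0 = z.1 ∧ φ₂ 0 = z.2 ∧
    φ₁ ζ₁ = a ∧ φ₂ ζ₁ = 0 ∧ φ₁ ζ₂ = b ∧ φ₂ ζ₂ = 0 ∧ φ₁ ζ₃ = b ∧ φ₂ ζ₃ = ε ∧
    t = elog (‖ζ₁‖) + elog (‖ζ₂‖) + elog (‖ζ₃‖) }

/-- Coman's Lempert function with the four simple poles
`(a,0)`, `(b,0)`, `(b,ε)`, `(a,ε)`. -/
def Leps4 (a b ε : ℂ) (z : ℂ × ℂ) : EReal :=
  sInf { t : EReal | ∃ (φ₁ φ₂ : ℂ → ℂ) (ζ₁ ζ₂ ζ₃ ζ₄ : ℂ),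
    AnalyticDisc2 φ₁ φ₂ ∧ ζ₁ ∈ unitDisc ∧ ζ₂ ∈ unitDisc ∧ ζ₃ ∈ unitDisc ∧ ζ₄ ∈ unitDisc ∧
    φ₁ 0 = z.1 ∧ φ₂ 0 = z.2 ∧
    φ₁ ζ₁ = a ∧ φ₂ ζ₁ = 0 ∧ φ₁ ζ₂ = b ∧ φ₂ ζ₂ = 0 ∧
    φ₁ ζ₃ = b ∧ φ₂ ζ₃ = ε ∧ φ₁ ζ₄ = a ∧ φ₂ ζ₄ = ε ∧
    t = elog (‖ζ₁‖) + elog (‖ζ₂‖)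
        + elog (‖ζ₃‖) + elog (‖ζ₄‖) }


lemma mem_uD (w : ℂ) : w ∈ unitDisc ↔ ‖w‖ < 1 := by simp [unitDisc]

lemma isOpen_uD : IsOpen unitDisc := Metric.isOpen_ball

lemma mobius_den_ne {ξ w : ℂ} (hξ : ‖ξ‖ < 1) (hw : ‖w‖ ≤ 1) :
    1 - (starRingEnd ℂ) ξ * w ≠ 0 := by
  intro h
  have h1 : (starRingEnd ℂ) ξ * w = 1 := by linear_combination -h
  have h2 : ‖ξ‖ * ‖w‖ = 1 := by
    have := congrArg norm h1
    simpa using this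
  nlinarith [norm_nonneg ξ, norm_nonneg w]

lemma mobius_norm_lt {ξ w : ℂ} (hξ : ‖ξ‖ < 1) (hw : ‖w‖ < 1) : ‖mobius ξ w‖ < 1 := by
  have hd := mobius_den_ne hξ hw.le
  unfold mobius
  rw [norm_div, div_lt_one (norm_pos_iff.mpr hd)]
  apply lt_of_pow_lt_pow_left₀ 2 (norm_nonneg _)
  have key : ‖1 - (starRingEnd ℂ) ξ * w‖ ^ 2 - ‖ξ - w‖ ^ 2 = (1 - ‖ξ‖ ^ 2) * (1 - ‖w‖ ^ 2) := by
    simp only [← Complex.normSq_eq_norm_sq, Complex.normSq_apply]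
    simp
    ring
  have h1 : 0 < 1 - ‖ξ‖ ^ 2 := by nlinarith [norm_nonneg ξ]
  have h2 : 0 < 1 - ‖w‖ ^ 2 := by nlinarith [norm_nonneg w]
  nlinarith [mul_pos h1 h2]

lemma mobius_norm_one {ξ : ℂ} (hξ : ‖ξ‖ < 1) : ‖mobius ξ 1‖ = 1 := by
  have hd := mobius_den_ne hξ (w := 1) (by simp)
  unfold mobius
  rw [norm_div, div_eq_one_iff_eq (norm_ne_zero_iff.mpr hd), mul_one,
    ← Complex.norm_conj (1 - (starRingEnd ℂ) ξ), norm_sub_rev]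
  simp

lemma mobius_diffAt {ξ w : ℂ} (hξ : ‖ξ‖ < 1) (hw : ‖w‖ ≤ 1) :
    DifferentiableAt ℂ (mobius ξ) w := by
  unfold mobius
  exact ((differentiableAt_const _).sub differentiableAt_id).div
    ((differentiableAt_const _).sub ((differentiableAt_const _).mul differentiableAt_id))
    (mobius_den_ne hξ hw)

/-- A Blaschke product of degree three taking a prescribed positive value. -/
lemma exists_blaschke {ζ₁ ζ₂ : ℂ} (h1 : ‖ζ₁‖ < 1) (h2 : ‖ζ₂‖ < 1) {s : ℝ} (hs0 : 0 < s)
    (hs1 : s < 1) : ∃ (B : ℂ → ℂ) (ζ₃ : ℂ), DifferentiableOn ℂ B unitDisc ∧ ‖ζ₃‖ < 1 ∧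
      (∀ w, ‖w‖ < 1 → ‖B w‖ < 1) ∧ B 0 = 0 ∧ B ζ₁ = 0 ∧ B ζ₂ = 0 ∧ B ζ₃ = s := by
  set B : ℂ → ℂ := fun w => w * mobius ζ₁ w * mobius ζ₂ w with hB
  have hBd : ∀ w : ℂ, ‖w‖ ≤ 1 → DifferentiableAt ℂ B w := fun w hw =>
    (differentiableAt_id.mul (mobius_diffAt h1 hw)).mul (mobius_diffAt h2 hw)
  have hcont : ContinuousOn (fun t : ℝ => ‖B t‖) (Set.Icc 0 1) := by
    intro t ht
    have : ContinuousAt B (t : ℂ) := (hBd t (by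
      rw [Complex.norm_real, Real.norm_eq_abs, abs_of_nonneg ht.1]; exact ht.2)).continuousAt
    have h' : ContinuousAt (fun t : ℝ => B t) t :=
      ContinuousAt.comp (f := fun t : ℝ => (t : ℂ)) this Complex.continuous_ofReal.continuousAt
    exact h'.norm.continuousWithinAt
  have hB1 : ‖B (1 : ℝ)‖ = 1 := by simp [hB, mobius_norm_one h1, mobius_norm_one h2]
  have hB0 : ‖B (0 : ℝ)‖ = 0 := by simp [hB]
  obtain ⟨t, ht, hts⟩ := intermediate_value_Icc (zero_le_one) hcont
    (show s ∈ Set.Icc _ _ by simp only [hB1, hB0]; exact ⟨hs0.le, hs1.le⟩)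
  simp only at hts
  have ht1 : t < 1 := by
    rcases ht.2.lt_or_eq with h | h
    · exact h
    · rw [h, hB1] at hts; linarith
  have hBt : B t ≠ 0 := by rw [← norm_ne_zero_iff, hts]; exact hs0.ne'
  refine ⟨fun w => (s / B t) * B w, t, ?_, ?_, ?_, ?_, ?_, ?_, ?_⟩
  · intro w hw
    exact ((hBd w ((mem_uD w).1 hw).le).const_mul _).differentiableWithinAt
  · rw [Complex.norm_real, Real.norm_eq_abs, abs_of_nonneg ht.1]; exact ht1
  · intro w hw
    rw [norm_mul, norm_div, hts, Complex.norm_real, Real.norm_eq_abs, abs_of_pos hs0,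
      div_self hs0.ne', one_mul]
    simp only [hB, norm_mul]
    have := mobius_norm_lt h1 hw
    have := mobius_norm_lt h2 hw
    calc ‖w‖ * ‖mobius ζ₁ w‖ * ‖mobius ζ₂ w‖ ≤ ‖w‖ * 1 * 1 := by gcongr
      _ < 1 := by linarith
  · simp [hB]
  · simp [hB, mobius]
  · simp [hB, mobius]
  · field_simp

lemma norm_sin_sq_add (w : ℂ) :
    ‖Complex.sin w ^ 2‖ + ‖1 - Complex.sin w ^ 2‖ = Real.cosh (2 * w.im) := by
  have h : 1 - Complex.sin w ^ 2 = Complex.cos w ^ 2 := by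
    linear_combination -(Complex.sin_sq_add_cos_sq w)
  rw [h, norm_pow, norm_pow, ← Complex.normSq_eq_norm_sq, ← Complex.normSq_eq_norm_sq]
  have hs : Complex.sin w = ((Real.sin w.re * Real.cosh w.im : ℝ) : ℂ)
      + ((Real.cos w.re * Real.sinh w.im : ℝ) : ℂ) * Complex.I := by
    rw [Complex.sin_eq w]; push_cast; ring
  have hc : Complex.cos w = ((Real.cos w.re * Real.cosh w.im : ℝ) : ℂ)
      + ((-(Real.sin w.re * Real.sinh w.im) : ℝ) : ℂ) * Complex.I := by
    rw [Complex.cos_eq w]; push_cast; ring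
  rw [hs, hc, Complex.normSq_add_mul_I, Complex.normSq_add_mul_I, Real.cosh_two_mul]
  linear_combination (Real.cosh w.im ^ 2 + Real.sinh w.im ^ 2) * Real.sin_sq_add_cos_sq w.re

lemma exists_G {η : ℝ} (hη : 0 < η) : ∃ (s : ℝ) (G : ℂ → ℂ), 0 < s ∧ s < 1 ∧
    DifferentiableOn ℂ G unitDisc ∧ G 0 = 0 ∧ G s = 1 ∧
    ∀ w, ‖w‖ < 1 → ‖G w‖ + ‖1 - G w‖ ≤ 1 + η := by
  obtain ⟨κ, hκ, hcosh⟩ : ∃ κ : ℝ, 0 < κ ∧ Real.cosh (κ * (Real.pi / 2)) ≤ 1 + η := by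
    have hc : Tendsto (fun κ : ℝ => Real.cosh (κ * (Real.pi / 2))) (𝓝[>] 0) (𝓝 1) := by
      have : Continuous (fun κ : ℝ => Real.cosh (κ * (Real.pi / 2))) := by fun_prop
      have h0 := this.tendsto 0
      simp only [zero_mul, Real.cosh_zero] at h0
      exact h0.mono_left nhdsWithin_le_nhds
    have := (hc.eventually_le_const (show (1 : ℝ) < 1 + η by linarith)).and self_mem_nhdsWithin
    obtain ⟨κ, h1, h2⟩ := this.exists
    exact ⟨κ, h2, h1⟩
  have hre : ∀ w : ℂ, ‖w‖ < 1 → 0 < ((1 + w) / (1 - w)).re := by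
    intro w hw
    have hne : 1 - w ≠ 0 := by
      intro h
      have : w = 1 := by linear_combination -h
      rw [this] at hw; simp at hw
    have hpos : 0 < Complex.normSq (1 - w) := Complex.normSq_pos.mpr hne
    have e : ((1 + w) / (1 - w)).re = (1 - ‖w‖ ^ 2) / Complex.normSq (1 - w) := by
      rw [Complex.div_re, ← add_div, ← Complex.normSq_eq_norm_sq, Complex.normSq_apply w]
      simp; ring
    rw [e]
    apply div_pos _ hpos
    nlinarith [norm_nonneg w]
  set E : ℝ := Real.exp (Real.pi / κ) with hE
  have hE1 : 1 < E := Real.one_lt_exp_iff.mpr (by positivity)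
  refine ⟨(E - 1) / (E + 1), fun w => Complex.sin (κ / 2 * Complex.log ((1 + w) / (1 - w))) ^ 2,
    ?_, ?_, ?_, ?_, ?_, ?_⟩
  · apply div_pos <;> linarith
  · rw [div_lt_one] <;> linarith
  · intro w hw
    rw [mem_uD] at hw
    have hne : 1 - w ≠ 0 := by
      intro h
      have : w = 1 := by linear_combination -h
      rw [this] at hw; simp at hw
    have hlog : DifferentiableAt ℂ (fun w => Complex.log ((1 + w) / (1 - w))) w := by
      apply DifferentiableAt.clog
      · exact ((differentiableAt_const _).add differentiableAt_id).div
          ((differentiableAt_const _).sub differentiableAt_id) hne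
      · exact Or.inl (hre w hw)
    exact ((hlog.const_mul _).csin.pow 2).differentiableWithinAt
  · simp
  · have hq : (1 + (((E - 1) / (E + 1) : ℝ) : ℂ)) / (1 - (((E - 1) / (E + 1) : ℝ) : ℂ)) = (E : ℂ) := by
      have : (1 + (E - 1) / (E + 1)) / (1 - (E - 1) / (E + 1)) = E := by
        have h1 : E + 1 ≠ 0 := by linarith
        have h2 : 1 - (E - 1) / (E + 1) = 2 / (E + 1) := by field_simp; ring
        rw [h2]; field_simp; ring
      exact_mod_cast this
    simp only [hq]
    rw [← Complex.ofReal_log (by linarith), hE, Real.log_exp]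
    have : ((κ : ℂ) / 2 * ((Real.pi / κ : ℝ) : ℂ)) = (Real.pi : ℂ) / 2 := by
      have : (κ : ℂ) ≠ 0 := by exact_mod_cast hκ.ne'
      push_cast; field_simp
    rw [this]; simp
  · intro w hw
    rw [norm_sin_sq_add]
    refine le_trans ?_ hcosh
    rw [Real.cosh_le_cosh]
    have him : (κ / 2 * Complex.log ((1 + w) / (1 - w))).im
        = κ / 2 * Complex.arg ((1 + w) / (1 - w)) := by
      rw [show (κ : ℂ) / 2 = ((κ / 2 : ℝ) : ℂ) by push_cast; rfl, Complex.im_ofReal_mul]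
      rw [Complex.log_im]
    rw [him, show 2 * (κ / 2 * Complex.arg ((1 + w) / (1 - w)))
      = κ * Complex.arg ((1 + w) / (1 - w)) by ring, abs_mul, abs_mul, abs_of_pos hκ,
      abs_of_pos (show (0 : ℝ) < Real.pi / 2 by positivity)]
    gcongr
    exact Complex.abs_arg_le_pi_div_two_iff.mpr (hre w hw).le

lemma exists_h {η : ℝ} (hη : 0 < η) {ζ₁ ζ₂ : ℂ} (h1 : ‖ζ₁‖ < 1) (h2 : ‖ζ₂‖ < 1) :
    ∃ (h : ℂ → ℂ) (ζ₃ : ℂ), DifferentiableOn ℂ h unitDisc ∧ ‖ζ₃‖ < 1 ∧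
      (∀ w, ‖w‖ < 1 → ‖h w‖ + ‖1 - h w‖ ≤ 1 + η) ∧ h 0 = 0 ∧ h ζ₁ = 0 ∧ h ζ₂ = 0 ∧ h ζ₃ = 1 := by
  obtain ⟨s, G, hs0, hs1, hG, hG0, hGs, hGb⟩ := exists_G hη
  obtain ⟨B, ζ₃, hB, h3, hBb, hB0, hB1, hB2, hB3⟩ := exists_blaschke h1 h2 hs0 hs1
  refine ⟨fun w => G (B w), ζ₃, ?_, h3, fun w hw => hGb _ (hBb w hw), ?_, ?_, ?_, ?_⟩
  · exact hG.comp hB (fun w hw => (mem_uD _).2 (hBb w ((mem_uD _).1 hw)))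
  all_goals simp only [*]

lemma exists_dil {f : ℂ → ℂ} (hf : DifferentiableOn ℂ f unitDisc)
    (hfm : ∀ w ∈ unitDisc, f w ∈ unitDisc) {r : ℝ} (hr0 : 0 < r) (hr1 : r < 1) :
    DifferentiableOn ℂ (fun w => f (r * w)) unitDisc ∧
    ∃ ρ : ℝ, ρ < 1 ∧ ∀ w ∈ unitDisc, ‖f (r * w)‖ ≤ ρ := by
  have hmul : ∀ w ∈ unitDisc, ‖(r : ℂ) * w‖ ≤ r := by
    intro w hw
    rw [mem_uD] at hw
    rw [norm_mul, Complex.norm_real, Real.norm_eq_abs, abs_of_pos hr0]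
    nlinarith
  constructor
  · apply hf.comp (differentiable_id.const_mul _).differentiableOn
    intro w hw
    exact (mem_uD _).2 ((hmul w hw).trans_lt hr1)
  · have hsub : closedBall (0 : ℂ) r ⊆ unitDisc := Metric.closedBall_subset_ball hr1
    obtain ⟨x, hx, hmax⟩ := (isCompact_closedBall (0 : ℂ) r).exists_isMaxOn
      ⟨0, by simp [hr0.le]⟩ ((hf.continuousOn.mono hsub).norm)
    refine ⟨‖f x‖, (mem_uD _).1 (hfm x (hsub hx)), fun w hw => ?_⟩
    exact hmax (show (r : ℂ) * w ∈ closedBall (0 : ℂ) r by simpa using hmul w hw)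

lemma convex_comb_mem {h u v : ℂ} {ρ : ℝ} (hρ0 : 0 ≤ ρ) (hu : ‖u‖ ≤ ρ) (hv : ‖v‖ ≤ ρ)
    (hρ1 : ρ < 1) (hh : ‖h‖ + ‖1 - h‖ ≤ 1 + (1 - ρ)) :
    (1 - h) * u + h * v ∈ unitDisc := by
  rw [mem_uD]
  calc ‖(1 - h) * u + h * v‖ ≤ ‖(1 - h) * u‖ + ‖h * v‖ := norm_add_le _ _
    _ = ‖1 - h‖ * ‖u‖ + ‖h‖ * ‖v‖ := by rw [norm_mul, norm_mul]
    _ ≤ ‖1 - h‖ * ρ + ‖h‖ * ρ := by gcongr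
    _ = (‖h‖ + ‖1 - h‖) * ρ := by ring
    _ ≤ (1 + (1 - ρ)) * ρ := by gcongr
    _ < 1 := by nlinarith [sq_pos_of_pos (sub_pos.2 hρ1)]

lemma elog_nonpos {x : ℝ} (h0 : 0 ≤ x) (h1 : x ≤ 1) : elog x ≤ 0 := by
  unfold elog
  split_ifs
  · exact bot_le
  · exact_mod_cast Real.log_nonpos h0 h1

lemma elog_of_ne {x : ℝ} (h : x ≠ 0) : elog x = ((Real.log x : ℝ) : EReal) := by
  simp [elog, h]

/-- First half, at the level of a single disc strictly inside the bidisc. -/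
lemma Leps3_le_core1 {a b ε : ℂ} {z : ℂ × ℂ} (hb : ‖b‖ < 1) (hε : ‖ε‖ < 1)
    {f₁ f₂ : ℂ → ℂ} {ζ₁ ζ₂ : ℂ} {ρ : ℝ} (hρ : ρ < 1)
    (d1 : DifferentiableOn ℂ f₁ unitDisc) (d2 : DifferentiableOn ℂ f₂ unitDisc)
    (m1 : ∀ w ∈ unitDisc, ‖f₁ w‖ ≤ ρ) (m2 : ∀ w ∈ unitDisc, ‖f₂ w‖ ≤ ρ)
    (h1 : ‖ζ₁‖ < 1) (h2 : ‖ζ₂‖ < 1) (e1 : f₁ 0 = z.1) (e2 : f₂ 0 = z.2)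
    (e3 : f₁ ζ₁ = a) (e4 : f₂ ζ₁ = 0) (e5 : f₁ ζ₂ = b) (e6 : f₂ ζ₂ = 0) :
    Leps3 a b ε z ≤ elog ‖ζ₁‖ + elog ‖ζ₂‖ := by
  set ρ' := max ρ (max ‖b‖ ‖ε‖) with hρ'
  have hρ'1 : ρ' < 1 := max_lt hρ (max_lt hb hε)
  have hbρ : ‖b‖ ≤ ρ' := le_max_of_le_right (le_max_left _ _)
  have hερ : ‖ε‖ ≤ ρ' := le_max_of_le_right (le_max_right _ _)
  have hρ0 : 0 ≤ ρ' := (norm_nonneg b).trans hbρ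
  obtain ⟨h, ζ₃, dh, h3, hh, g0, g1, g2, g3⟩ := exists_h (sub_pos.2 hρ'1) h1 h2
  have dd : ∀ (f : ℂ → ℂ) (c : ℂ), DifferentiableOn ℂ f unitDisc →
      DifferentiableOn ℂ (fun w => (1 - h w) * f w + h w * c) unitDisc := fun f c hf =>
    (((differentiableOn_const _).sub dh).mul hf).add (dh.mul (differentiableOn_const _))
  refine le_trans (b := elog ‖ζ₁‖ + elog ‖ζ₂‖ + elog ‖ζ₃‖) ?_ ?_
  · apply sInf_le
    refine ⟨fun w => (1 - h w) * f₁ w + h w * b, fun w => (1 - h w) * f₂ w + h w * ε, ζ₁, ζ₂, ζ₃,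
      ⟨dd _ _ d1, dd _ _ d2, ?_, ?_⟩, (mem_uD _).2 h1, (mem_uD _).2 h2, (mem_uD _).2 h3,
      by simp [*], by simp [*], by simp [*], by simp [*], by simp [*], by simp [*],
      by simp [*], by simp [*], rfl⟩
    · exact fun w hw => convex_comb_mem hρ0 ((m1 w hw).trans (le_max_left _ _)) hbρ hρ'1
        (hh w ((mem_uD _).1 hw))
    · exact fun w hw => convex_comb_mem hρ0 ((m2 w hw).trans (le_max_left _ _)) hερ hρ'1
        (hh w ((mem_uD _).1 hw))
  · calc _ ≤ elog ‖ζ₁‖ + elog ‖ζ₂‖ + 0 := by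
          gcongr
          exact elog_nonpos (norm_nonneg _) h3.le
      _ = _ := add_zero _

lemma exists_lam (d : ℂ) : ∃ l : ℂ → ℂ, Tendsto l (𝓝[≠] 0) (𝓝[≠] 0) ∧
    Tendsto (fun ε => (ε - d * l ε) / l ε) (𝓝[≠] 0) (𝓝 0) := by
  have hid : Tendsto (fun ε : ℂ => ε) (𝓝[≠] 0) (𝓝 0) := nhdsWithin_le_nhds
  by_cases hd : d = 0
  · subst hd
    have hs : Tendsto (fun ε : ℂ => Real.sqrt ‖ε‖) (𝓝[≠] 0) (𝓝 0) := by
      have : Continuous (fun ε : ℂ => Real.sqrt ‖ε‖) := by fun_prop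
      have h0 := this.tendsto 0
      simp only [norm_zero, Real.sqrt_zero] at h0
      exact h0.mono_left nhdsWithin_le_nhds
    refine ⟨fun ε => (Real.sqrt ‖ε‖ : ℂ), ?_, ?_⟩
    · rw [tendsto_nhdsWithin_iff]
      refine ⟨?_, ?_⟩
      · have := (Complex.continuous_ofReal.tendsto 0).comp hs
        simpa [Function.comp_def] using this
      · filter_upwards [self_mem_nhdsWithin] with ε hε
        simpa using hε
    · rw [tendsto_zero_iff_norm_tendsto_zero]
      refine hs.congr (fun ε => ?_)
      simp only [zero_mul, sub_zero, norm_div, Complex.norm_real, Real.norm_eq_abs,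
        abs_of_nonneg (Real.sqrt_nonneg _)]
      rw [Real.div_sqrt]
  · refine ⟨fun ε => ε / d, ?_, ?_⟩
    · rw [tendsto_nhdsWithin_iff]
      refine ⟨by simpa using hid.div_const d, ?_⟩
      filter_upwards [self_mem_nhdsWithin] with ε hε
      exact div_ne_zero hε hd
    · have : (fun ε => (ε - d * (ε / d)) / (ε / d)) = fun _ => 0 := by
        funext ε
        rw [mul_div_cancel₀ _ hd]; simp
      rw [this]; exact tendsto_const_nhds

lemma corr_tendsto {f : ℂ → ℂ} {ζ₁ ζ₂ d : ℂ} (hf : HasDerivAt f d ζ₂) (h2 : ζ₂ ≠ 0)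
    (h12 : ζ₂ ≠ ζ₁) {l v : ℂ → ℂ} (hl : Tendsto l (𝓝[≠] 0) (𝓝[≠] 0))
    (hv : Tendsto (fun ε => (v ε - f ζ₂ - d * l ε) / l ε) (𝓝[≠] 0) (𝓝 0)) :
    Tendsto (fun ε => (v ε - f (ζ₂ + l ε)) / ((ζ₂ + l ε) * (ζ₂ + l ε - ζ₁) * l ε))
      (𝓝[≠] 0) (𝓝 0) := by
  have hl0 : Tendsto l (𝓝[≠] 0) (𝓝 0) := hl.mono_right nhdsWithin_le_nhds
  have hsl := hf.tendsto_slope_zero.comp hl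
  have hq : Tendsto (fun ε => (ζ₂ + l ε) * (ζ₂ + l ε - ζ₁)) (𝓝[≠] 0) (𝓝 (ζ₂ * (ζ₂ - ζ₁))) := by
    have h := hl0.const_add ζ₂
    rw [add_zero] at h
    exact h.mul (h.sub_const _)
  have hlim := ((hv.add_const d).sub hsl).div hq (mul_ne_zero h2 (sub_ne_zero.2 h12))
  simp only [zero_add, sub_self, zero_div] at hlim
  refine hlim.congr' ?_
  have hne : ∀ᶠ ε in 𝓝[≠] (0 : ℂ), l ε ≠ 0 := hl self_mem_nhdsWithin
  filter_upwards [hne] with ε hε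
  simp only [Pi.div_apply, Function.comp, smul_eq_mul]
  symm
  rw [mul_comm ((ζ₂ + l ε) * (ζ₂ + l ε - ζ₁)) (l ε), ← div_div]
  congr 1
  field_simp
  ring

lemma P_norm_le {ζ₁ ζ₂ w : ℂ} (h1 : ‖ζ₁‖ < 1) (h2 : ‖ζ₂‖ < 1) (hw : ‖w‖ < 1) :
    ‖w * (w - ζ₁) * (w - ζ₂)‖ ≤ 4 := by
  rw [norm_mul, norm_mul]
  have := norm_sub_le w ζ₁
  have := norm_sub_le w ζ₂
  calc _ ≤ 1 * 2 * (2 : ℝ) := by gcongr <;> linarith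
    _ = 4 := by norm_num

/-- Second half, at the level of a single disc strictly inside the bidisc. -/
lemma limsup_core2 {a b : ℂ} {z : ℂ × ℂ} {f₁ f₂ : ℂ → ℂ} {ζ₁ ζ₂ : ℂ} {ρ : ℝ} (hρ : ρ < 1)
    (d1 : DifferentiableOn ℂ f₁ unitDisc) (d2 : DifferentiableOn ℂ f₂ unitDisc)
    (m1 : ∀ w ∈ unitDisc, ‖f₁ w‖ ≤ ρ) (m2 : ∀ w ∈ unitDisc, ‖f₂ w‖ ≤ ρ)
    (h1 : ‖ζ₁‖ < 1) (h2 : ‖ζ₂‖ < 1) (n1 : ζ₁ ≠ 0) (n2 : ζ₂ ≠ 0) (n12 : ζ₂ ≠ ζ₁)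
    (e1 : f₁ 0 = z.1) (e2 : f₂ 0 = z.2)
    (e3 : f₁ ζ₁ = a) (e4 : f₂ ζ₁ = 0) (e5 : f₁ ζ₂ = b) (e6 : f₂ ζ₂ = 0)
    (hd : HasDerivAt f₁ 0 ζ₂) :
    limsup (fun ε => Leps3 a b ε z) (𝓝[≠] (0 : ℂ)) ≤
      ((Real.log ‖ζ₁‖ + Real.log ‖ζ₂‖ + Real.log ‖ζ₂‖ : ℝ) : EReal) := by
  have hd2 : HasDerivAt f₂ (deriv f₂ ζ₂) ζ₂ :=
    (d2.differentiableAt (isOpen_uD.mem_nhds ((mem_uD _).2 h2))).hasDerivAt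
  obtain ⟨l, hl, hlv⟩ := exists_lam (deriv f₂ ζ₂)
  have c1 := corr_tendsto (ζ₁ := ζ₁) (v := fun _ => b) hd n2 n12 hl (by
    simp [e5])
  have c2 := corr_tendsto (ζ₁ := ζ₁) (v := fun ε => ε) hd2 n2 n12 hl (by
    simpa [e6] using hlv)
  have hl0 : Tendsto l (𝓝[≠] 0) (𝓝 0) := hl.mono_right nhdsWithin_le_nhds
  have h3 : Tendsto (fun ε => ζ₂ + l ε) (𝓝[≠] 0) (𝓝 ζ₂) := by
    simpa using hl0.const_add ζ₂
  have hF : Tendsto (fun ε => ((Real.log ‖ζ₁‖ + Real.log ‖ζ₂‖ + Real.log ‖ζ₂ + l ε‖ : ℝ) : EReal))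
      (𝓝[≠] 0) (𝓝 ((Real.log ‖ζ₁‖ + Real.log ‖ζ₂‖ + Real.log ‖ζ₂‖ : ℝ) : EReal)) := by
    apply (continuous_coe_real_ereal.tendsto _).comp
    exact (h3.norm.log (norm_ne_zero_iff.2 n2)).const_add _
  rw [← hF.limsup_eq]
  apply limsup_le_limsup
  swap
  · isBoundedDefault
  swap
  · isBoundedDefault
  have hsm : (0 : ℝ) < (1 - ρ) / 4 := by linarith
  have s1 := c1.norm.eventually_lt_const (by rw [norm_zero]; exact hsm)
  have s2 := c2.norm.eventually_lt_const (by rw [norm_zero]; exact hsm)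
  have b3 := h3.norm.eventually_lt_const h2
  have z3 := h3.eventually_ne n2
  have q3 := h3.eventually_ne n12
  have hne : ∀ᶠ ε in 𝓝[≠] (0 : ℂ), l ε ≠ 0 := hl self_mem_nhdsWithin
  filter_upwards [s1, s2, b3, z3, q3, hne] with ε s1 s2 b3 z3 q3 hne
  set k1 := (b - f₁ (ζ₂ + l ε)) / ((ζ₂ + l ε) * (ζ₂ + l ε - ζ₁) * l ε) with hk1
  set k2 := (ε - f₂ (ζ₂ + l ε)) / ((ζ₂ + l ε) * (ζ₂ + l ε - ζ₁) * l ε) with hk2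
  have hden : (ζ₂ + l ε) * (ζ₂ + l ε - ζ₁) * l ε ≠ 0 :=
    mul_ne_zero (mul_ne_zero z3 (sub_ne_zero.2 q3)) hne
  have hmem : ∀ (f : ℂ → ℂ) (k : ℂ), (∀ w ∈ unitDisc, ‖f w‖ ≤ ρ) → ‖k‖ < (1 - ρ) / 4 →
      ∀ w ∈ unitDisc, f w + k * (w * (w - ζ₁) * (w - ζ₂)) ∈ unitDisc := by
    intro f k hf hk w hw
    have hP := P_norm_le h1 h2 ((mem_uD _).1 hw)
    rw [mem_uD]
    calc _ ≤ ‖f w‖ + ‖k * (w * (w - ζ₁) * (w - ζ₂))‖ := norm_add_le _ _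
      _ ≤ ρ + ‖k‖ * 4 := by
        rw [norm_mul]
        gcongr
        exact hf w hw
      _ < 1 := by linarith
  have hdf : ∀ (f : ℂ → ℂ) (k : ℂ), DifferentiableOn ℂ f unitDisc →
      DifferentiableOn ℂ (fun w => f w + k * (w * (w - ζ₁) * (w - ζ₂))) unitDisc := by
    intro f k hf
    apply hf.add
    apply Differentiable.differentiableOn
    fun_prop
  apply sInf_le
  refine ⟨_, _, ζ₁, ζ₂, ζ₂ + l ε, ⟨hdf f₁ k1 d1, hdf f₂ k2 d2, hmem f₁ k1 m1 s1, hmem f₂ k2 m2 s2⟩,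
    (mem_uD _).2 h1, (mem_uD _).2 h2, (mem_uD _).2 b3, by simp [e1], by simp [e2], by simp [e3],
    by simp [e4], by simp [e5], by simp [e6], ?_, ?_, ?_⟩
  · simp only [add_sub_cancel_left]
    rw [hk1, div_mul_cancel₀ _ hden]; ring
  · simp only [add_sub_cancel_left]
    rw [hk2, div_mul_cancel₀ _ hden]; ring
  · rw [elog_of_ne (norm_ne_zero_iff.2 n1), elog_of_ne (norm_ne_zero_iff.2 n2),
      elog_of_ne (norm_ne_zero_iff.2 z3)]
    push_cast; rfl

lemma norm_div_r {ζ : ℂ} {r : ℝ} (hr : 0 < r) : ‖ζ / (r : ℂ)‖ = ‖ζ‖ / r := by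
  rw [norm_div, Complex.norm_real, Real.norm_eq_abs, abs_of_pos hr]

lemma log_div_tendsto {ζ : ℂ} (h : ζ ≠ 0) :
    Tendsto (fun r : ℝ => Real.log ‖ζ / (r : ℂ)‖) (𝓝[<] 1) (𝓝 (Real.log ‖ζ‖)) := by
  have hc : Tendsto (fun r : ℝ => ζ / (r : ℂ)) (𝓝[<] 1) (𝓝 (ζ / ((1 : ℝ) : ℂ))) := by
    refine Tendsto.mono_left ?_ nhdsWithin_le_nhds
    exact tendsto_const_nhds.div (Complex.continuous_ofReal.tendsto 1) (by simp)
  rw [Complex.ofReal_one, div_one] at hc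
  exact hc.norm.log (norm_ne_zero_iff.2 h)

/-- Lemma `limsup`: if `log|z₂| > log|φ_a(z₁)| + log|φ_b(z₁)|`, then
`limsup_{ε→0, ε≠0} L^ε_{a0bV}(z) ≤ min {L_{a0b0}(z), L_{a0bV}(z)}`. -/
theorem limsup_Leps3_le
    (a b : ℂ) (ha : a ∈ unitDisc) (hb : b ∈ unitDisc) (hab : a ≠ b)
    (z : ℂ × ℂ) (hz1 : z.1 ∈ unitDisc) (hz2 : z.2 ∈ unitDisc)
    (hcond : elog (‖mobius a z.1‖) + elog (‖mobius b z.1‖)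
      < elog (‖z.2‖)) :
    Filter.limsup (fun ε => Leps3 a b ε z) (𝓝[≠] (0 : ℂ))
      ≤ min (La0b0 a b z) (La0bV a b z) := by
  have hz0 : z.2 ≠ 0 := by
    intro h
    simp [h, elog] at hcond
  rw [mem_uD] at hb
  -- the radii used for dilation
  have hrad : ∀ ζ : ℂ, ‖ζ‖ < 1 → ∀ᶠ r : ℝ in 𝓝[<] 1, 0 < r ∧ r < 1 ∧ ‖ζ / (r : ℂ)‖ < 1 := by
    intro ζ hζ
    have h1 : Set.Ioo (max 0 ‖ζ‖) 1 ∈ 𝓝[<] (1 : ℝ) :=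
      Ioo_mem_nhdsLT (max_lt one_pos hζ)
    filter_upwards [h1] with r hr
    have h0 : 0 < r := (le_max_left _ _).trans_lt hr.1
    refine ⟨h0, hr.2, ?_⟩
    rw [norm_div_r h0, div_lt_one h0]
    exact (le_max_right _ _).trans_lt hr.1
  have hcan : ∀ (ζ : ℂ) (r : ℝ), 0 < r → (r : ℂ) * (ζ / r) = ζ := by
    intro ζ r hr
    have : (r : ℂ) ≠ 0 := by exact_mod_cast hr.ne'
    field_simp
  apply le_min
  · apply le_sInf
    rintro t ⟨φ₁, φ₂, ζ₁, ζ₂, ⟨d1, d2, m1, m2⟩, h1, h2, e1, e2, e3, e4, e5, e6, rfl⟩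
    rw [mem_uD] at h1 h2
    have n1 : ζ₁ ≠ 0 := by rintro rfl; exact hz0 (e2.symm.trans e4)
    have n2 : ζ₂ ≠ 0 := by rintro rfl; exact hz0 (e2.symm.trans e6)
    rw [elog_of_ne (norm_ne_zero_iff.2 n1), elog_of_ne (norm_ne_zero_iff.2 n2), ← EReal.coe_add]
    have hT := (continuous_coe_real_ereal.tendsto _).comp
      ((log_div_tendsto n1).add (log_div_tendsto n2))
    refine ge_of_tendsto hT ?_
    filter_upwards [hrad ζ₁ h1, hrad ζ₂ h2] with r ⟨r0, r1, g1⟩ ⟨_, _, g2⟩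
    obtain ⟨D1, ρ1, l1, M1⟩ := exists_dil d1 m1 r0 r1
    obtain ⟨D2, ρ2, l2, M2⟩ := exists_dil d2 m2 r0 r1
    apply limsup_le_of_le
    · isBoundedDefault
    have hε : ∀ᶠ ε in 𝓝[≠] (0 : ℂ), ‖ε‖ < 1 := by
      filter_upwards [mem_nhdsWithin_of_mem_nhds (Metric.ball_mem_nhds (0 : ℂ) one_pos)] with ε h
      simpa using h
    filter_upwards [hε] with ε hε
    have := Leps3_le_core1 (a := a) (b := b) (z := z) hb hε (max_lt l1 l2) D1 D2
      (fun w hw => (M1 w hw).trans (le_max_left _ _))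
      (fun w hw => (M2 w hw).trans (le_max_right _ _)) g1 g2
      (by simpa using e1) (by simpa using e2) (by simpa only [hcan _ _ r0] using e3)
      (by simpa only [hcan _ _ r0] using e4) (by simpa only [hcan _ _ r0] using e5)
      (by simpa only [hcan _ _ r0] using e6)
    have hr' : (r : ℂ) ≠ 0 := by exact_mod_cast r0.ne'
    rw [elog_of_ne (norm_ne_zero_iff.2 (div_ne_zero n1 hr')),
      elog_of_ne (norm_ne_zero_iff.2 (div_ne_zero n2 hr')), ← EReal.coe_add] at this
    exact this
  · apply le_sInf
    rintro t ⟨φ₁, φ₂, ζ₁, ζ₂, ⟨d1, d2, m1, m2⟩, h1, h2, e1, e2, e3, e4, e5, e6, e7, rfl⟩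
    have hder : HasDerivAt φ₁ 0 ζ₂ := by
      rw [← e7]
      exact (d1.differentiableAt (isOpen_uD.mem_nhds h2)).hasDerivAt
    rw [mem_uD] at h1 h2
    have n1 : ζ₁ ≠ 0 := by rintro rfl; exact hz0 (e2.symm.trans e4)
    have n2 : ζ₂ ≠ 0 := by rintro rfl; exact hz0 (e2.symm.trans e6)
    have n12 : ζ₂ ≠ ζ₁ := by rintro rfl; exact hab (e3.symm.trans e5)
    rw [elog_of_ne (norm_ne_zero_iff.2 n1), elog_of_ne (norm_ne_zero_iff.2 n2), ← EReal.coe_add,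
      ← EReal.coe_add]
    have hT := (continuous_coe_real_ereal.tendsto _).comp
      (((log_div_tendsto n1).add (log_div_tendsto n2)).add (log_div_tendsto n2))
    refine ge_of_tendsto hT ?_
    filter_upwards [hrad ζ₁ h1, hrad ζ₂ h2] with r ⟨r0, r1, g1⟩ ⟨_, _, g2⟩
    obtain ⟨D1, ρ1, l1, M1⟩ := exists_dil d1 m1 r0 r1
    obtain ⟨D2, ρ2, l2, M2⟩ := exists_dil d2 m2 r0 r1
    have hr' : (r : ℂ) ≠ 0 := by exact_mod_cast r0.ne'
    have hder' : HasDerivAt (fun w => φ₁ (r * w)) 0 (ζ₂ / r) := by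
      have hm : HasDerivAt (fun w : ℂ => (r : ℂ) * w) r (ζ₂ / r) := by
        simpa using (hasDerivAt_id (ζ₂ / (r : ℂ))).const_mul (r : ℂ)
      have := HasDerivAt.comp (h₂ := φ₁) (h₂' := 0) (ζ₂ / (r : ℂ)) (by rw [hcan _ _ r0]; exact hder) hm
      simpa [Function.comp_def] using this
    exact limsup_core2 (a := a) (b := b) (z := z) (max_lt l1 l2) D1 D2
      (fun w hw => (M1 w hw).trans (le_max_left _ _))
      (fun w hw => (M2 w hw).trans (le_max_right _ _)) g1 g2
      (div_ne_zero n1 hr') (div_ne_zero n2 hr')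
      (fun h => n12 (by rw [← hcan ζ₂ r r0, h, hcan _ _ r0]))
      (by simpa using e1) (by simpa using e2) (by simpa only [hcan _ _ r0] using e3)
      (by simpa only [hcan _ _ r0] using e4) (by simpa only [hcan _ _ r0] using e5)
      (by simpa only [hcan _ _ r0] using e6) hder'
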